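/- arXiv:2306.04638 — 3 statements merged into one kernel-verified Lean document; each statement's English description precedes it below -/
import Mathlib

section
/- For every real ψ with 0 < ψ < π/4, the convergent series ∑_{k=0}^∞ (C(4k,2k)/2^{6k})·(4·cos²(2ψ))^k·H_k equals log( (csc ψ + √2)²/(4·(cot ψ + 1)) )/(√2·sin ψ) + log( (sec ψ + √2)²/(4·(tan ψ + 1)) )/(√2·cos ψ). -/
open scoped BigOperators
open Real

/-- The `m`-th harmonic number `H_m = ∑_{j=1}^m 1/j`. -/
noncomputable def harmonicNum (m : ℕ) : ℝ := ∑ j ∈ Finset.range m, 1 / (j + 1 : ℝ)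

lemma succ_mul_ringChoose_succ (r : ℝ) (n : ℕ) :
    ((n : ℝ) + 1) * Ring.choose r (n + 1) = (r - n) * Ring.choose r n := by
  have h1 := Ring.descPochhammer_eq_factorial_smul_choose r (n + 1)
  have h2 := Ring.descPochhammer_eq_factorial_smul_choose r n
  rw [descPochhammer_succ_right, Polynomial.smeval_mul, h2] at h1
  have hf : (n.factorial : ℝ) ≠ 0 := by positivity
  apply mul_left_cancel₀ hf
  simp [Nat.factorial_succ, Polynomial.smeval_sub, Polynomial.smeval_X,
    Polynomial.smeval_natCast] at h1
  linear_combination -h1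

lemma ringChoose_neg_half (n : ℕ) :
    Ring.choose (-(1 / 2) : ℝ) n = (-1) ^ n * (n.centralBinom / 4 ^ n) := by
  induction n with
  | zero => simp
  | succ n ih =>
    have h1 := succ_mul_ringChoose_succ (-(1 / 2)) n
    have h2 : ((n : ℝ) + 1) * (n + 1).centralBinom = 2 * (2 * n + 1) * n.centralBinom := by
      exact_mod_cast Nat.succ_mul_centralBinom_succ n
    have hn : (n : ℝ) + 1 ≠ 0 := by positivity
    apply mul_left_cancel₀ hn
    rw [h1, ih, pow_succ, pow_succ]
    field_simp
    linear_combination 2 * h2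

lemma hasSum_centralBinom {x : ℝ} (hx : |x| < 1) :
    HasSum (fun n : ℕ => (n.centralBinom / 4 ^ n : ℝ) * x ^ n) (1 / √(1 - x)) := by
  have h := (Real.one_add_rpow_hasFPowerSeriesOnBall_zero (a := -(1 / 2))).hasSum
    (y := -x) (by simpa [enorm_eq_nnnorm, ← NNReal.coe_lt_coe] using hx)
  have hx' : 0 ≤ 1 - x := by linarith [(abs_lt.mp hx).2]
  convert! h using 1
  · ext n
    simp only [binomialSeries_apply, ringChoose_neg_half]
    simp only [List.ofFn_const, List.prod_replicate, smul_eq_mul, neg_pow x n]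
    have : ((-1 : ℝ) ^ n) * (-1) ^ n = 1 := by rw [← mul_pow]; simp
    linear_combination -(n.centralBinom / 4 ^ n : ℝ) * x ^ n * this
  · rw [Real.sqrt_eq_rpow, zero_add, ← sub_eq_add_neg, Real.rpow_neg hx', one_div]

lemma hasSum_centralBinom_even {x : ℝ} (hx : |x| < 1) :
    HasSum (fun k : ℕ => ((2 * k).centralBinom / 16 ^ k : ℝ) * x ^ (2 * k))
      ((1 / √(1 - x) + 1 / √(1 + x)) / 2) := by
  have h := ((hasSum_centralBinom hx).add (hasSum_centralBinom (x := -x) (by simpa))).div_const 2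
  rw [sub_neg_eq_add] at h
  have hinj : Function.Injective (fun k : ℕ => 2 * k) := fun a b hab => by simpa using hab
  rw [← hinj.hasSum_iff] at h
  · convert! h using 1
    ext k
    simp [pow_mul]
    norm_num
  · intro n hn
    have : Odd n := by
      rw [← Nat.not_even_iff_odd]
      rintro ⟨k, hk⟩
      exact hn ⟨k, by simp only; omega⟩
    simp [this.neg_pow]

/-- An antiderivative in `s` of `(1 / √(1 - x) - 1 / √(1 - x * s)) * (2 * s / (1 - s ^ 2))`. -/
noncomputable def sqrtPrimitive (x s : ℝ) : ℝ :=
  -(2 / √(1 - x)) * log (√(1 - x * s) + √(1 - x)) +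
    (-(√(1 + x) - √(1 - x)) * log (√(1 + x) - √(1 - x * s)) -
      (√(1 + x) + √(1 - x)) * log (√(1 + x) + √(1 - x * s))) / (√(1 - x) * √(1 + x))

lemma sqrt_sub_sqrt_ne_zero {x s : ℝ} (hx : |x| < 1) (hx0 : x ≠ 0) (hs0 : 0 ≤ s) (hs1 : s ≤ 1) :
    √(1 + x) - √(1 - x * s) ≠ 0 := by
  obtain ⟨h1, h2⟩ := abs_lt.mp hx
  intro h
  rw [sub_eq_zero, Real.sqrt_inj (by linarith) (by nlinarith)] at h
  have : x * (1 + s) = 0 := by linarith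
  rcases mul_eq_zero.mp this with h | h
  · exact hx0 h
  · linarith

lemma differentiableAt_sqrtPrimitive {x s : ℝ} (hx : |x| < 1) (hx0 : x ≠ 0)
    (hs0 : 0 ≤ s) (hs1 : s ≤ 1) : DifferentiableAt ℝ (sqrtPrimitive x) s := by
  obtain ⟨h1, h2⟩ := abs_lt.mp hx
  have hU : 0 < 1 - x * s := by nlinarith
  have hu : 0 < √(1 - x) := Real.sqrt_pos.mpr (by linarith)
  have hv : 0 < √(1 + x) := Real.sqrt_pos.mpr (by linarith)
  have hd := sqrt_sub_sqrt_ne_zero hx hx0 hs0 hs1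
  have hp : √(1 - x * s) + √(1 - x) ≠ 0 := by positivity
  have hq : √(1 + x) + √(1 - x * s) ≠ 0 := by positivity
  have hU' := hU.ne'
  unfold sqrtPrimitive
  fun_prop (disch := assumption)

lemma hasDerivAt_sqrtPrimitive {x s : ℝ} (hx : |x| < 1) (hx0 : x ≠ 0)
    (hs0 : 0 ≤ s) (hs1 : s < 1) :
    HasDerivAt (sqrtPrimitive x)
      ((1 / √(1 - x) - 1 / √(1 - x * s)) * (2 * s / (1 - s ^ 2))) s := by
  obtain ⟨h1, h2⟩ := abs_lt.mp hx
  have hU : 0 < 1 - x * s := by nlinarith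
  have hu : 0 < √(1 - x) := Real.sqrt_pos.mpr (by linarith)
  have hv : 0 < √(1 + x) := Real.sqrt_pos.mpr (by linarith)
  have hU0 : 0 < √(1 - x * s) := Real.sqrt_pos.mpr hU
  have hd := sqrt_sub_sqrt_ne_zero hx hx0 hs0 hs1.le
  have hp : √(1 - x * s) + √(1 - x) ≠ 0 := by positivity
  have hq : √(1 + x) + √(1 - x * s) ≠ 0 := by positivity
  have hsq : HasDerivAt (fun s => √(1 - x * s)) (-x / (2 * √(1 - x * s))) s := by
    have := ((hasDerivAt_id s).const_mul x).const_sub 1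
    simpa using this.sqrt hU.ne'
  have key := (((hsq.add_const √(1 - x)).log hp).const_mul (-(2 / √(1 - x)))).add
    ((((hsq.const_sub √(1 + x)).log hd).const_mul (-(√(1 + x) - √(1 - x)))).sub
      (((hsq.const_add √(1 + x)).log hq).const_mul (√(1 + x) + √(1 - x)))
      |>.div_const (√(1 - x) * √(1 + x)))
  refine HasDerivAt.congr_deriv key ?_
  have e1 : √(1 - x) ^ 2 = 1 - x := Real.sq_sqrt (by linarith)
  have e2 : √(1 + x) ^ 2 = 1 + x := Real.sq_sqrt (by linarith)
  have e3 : √(1 - x * s) ^ 2 = 1 - x * s := Real.sq_sqrt hU.le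
  generalize √(1 - x) = u at *
  generalize √(1 + x) = v at *
  generalize √(1 - x * s) = U at *
  have hs : 1 - s = (U ^ 2 - u ^ 2) / x := by field_simp; linarith
  have hs' : 1 + s = (v ^ 2 - U ^ 2) / x := by field_simp; linarith
  have hUu : U - u ≠ 0 := by
    intro h
    have : U = u := by linarith
    rw [this, sub_self, zero_div] at hs
    linarith
  have hfrac : 2 * s / (1 - s ^ 2) = 1 / (1 - s) - 1 / (1 + s) := by
    have : 1 - s ≠ 0 := by linarith
    have : 1 + s ≠ 0 := by linarith
    rw [show 1 - s ^ 2 = (1 - s) * (1 + s) by ring]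
    field_simp
    ring
  rw [hfrac, hs, hs', show U ^ 2 - u ^ 2 = (U - u) * (U + u) by ring,
    show v ^ 2 - U ^ 2 = (v - U) * (v + U) by ring]
  field_simp
  ring

lemma sqrtPrimitive_one_sub_zero {x : ℝ} (hx0 : 0 < x) (hx1 : x < 1) :
    ((sqrtPrimitive x 1 + sqrtPrimitive (-x) 1) - (sqrtPrimitive x 0 + sqrtPrimitive (-x) 0)) / 2 =
      (2 * log (1 + √(1 - x)) - log (2 * √(1 - x)) - log (√(1 - x) + √(1 + x))) / √(1 - x) +
      (2 * log (1 + √(1 + x)) - log (2 * √(1 + x)) - log (√(1 - x) + √(1 + x))) / √(1 + x) := by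
  have hu : 0 < √(1 - x) := Real.sqrt_pos.mpr (by linarith)
  have hv : 0 < √(1 + x) := Real.sqrt_pos.mpr (by linarith)
  have e1 : √(1 - x) ^ 2 = 1 - x := Real.sq_sqrt (by linarith)
  have e2 : √(1 + x) ^ 2 = 1 + x := Real.sq_sqrt (by linarith)
  simp only [sqrtPrimitive, sub_neg_eq_add, ← sub_eq_add_neg, mul_one, mul_zero, sub_zero,
    Real.sqrt_one, neg_mul x, neg_zero]
  generalize √(1 - x) = u at *
  generalize √(1 + x) = v at *
  have hlog : log (v - 1) + log (v + 1) = log (u - 1) + log (u + 1) := by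
    have hv1 : v ≠ 1 := by rintro rfl; linarith
    have hu1 : u ≠ 1 := by rintro rfl; linarith
    rw [← Real.log_mul (sub_ne_zero.mpr hv1) (by positivity),
      ← Real.log_mul (sub_ne_zero.mpr hu1) (by positivity), ← Real.log_neg_eq_log]
    congr 1
    linarith
  have hsub : log (u - v) = log (v - u) := by rw [← Real.log_neg_eq_log, neg_sub]
  have hL : log (v - 1) = log (u - 1) + log (u + 1) - log (v + 1) := by linarith
  rw [hsub, hL, add_comm v u, add_comm 1 u, add_comm 1 v, ← two_mul, ← two_mul]
  field_simp
  ring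

lemma centralBinom_div_le_one (k : ℕ) : ((2 * k).centralBinom / 16 ^ k : ℝ) ≤ 1 := by
  rw [div_le_one (by positivity)]
  have := Nat.centralBinom_le_four_pow (2 * k)
  rw [pow_mul] at this
  exact_mod_cast this

lemma summable_mul_pow_two_mul {x : ℝ} (hx : |x| < 1) :
    Summable (fun k : ℕ => 2 * ((k : ℝ) * x ^ (2 * k))) := by
  have : ‖x ^ 2‖ < 1 := by simpa using hx
  simpa [pow_mul] using (summable_pow_mul_geometric_of_norm_lt_one 1 this).mul_left 2

lemma summand_bound {x : ℝ} {k : ℕ} {c S : ℝ} (hS : |S| ≤ c) :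
    ‖((2 * k).centralBinom / 16 ^ k : ℝ) * x ^ (2 * k) * S‖ ≤ c * x ^ (2 * k) := by
  have hx : 0 ≤ x ^ (2 * k) := by rw [pow_mul]; positivity
  have ha : 0 ≤ ((2 * k).centralBinom / 16 ^ k : ℝ) := by positivity
  rw [Real.norm_eq_abs, abs_mul, abs_mul, abs_of_nonneg hx, abs_of_nonneg ha]
  calc _ ≤ 1 * x ^ (2 * k) * c := by
        gcongr
        exact centralBinom_div_le_one k
    _ = _ := by ring

lemma abs_sum_two_mul_pow_le {s : ℝ} (hs : |s| ≤ 1) (k : ℕ) :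
    |∑ j ∈ Finset.range k, 2 * s ^ (2 * j + 1)| ≤ 2 * k := by
  refine (Finset.abs_sum_le_sum_abs _ _).trans ?_
  calc _ ≤ ∑ j ∈ Finset.range k, (2 : ℝ) := by
        refine Finset.sum_le_sum fun j _ => ?_
        rw [abs_mul, abs_pow, abs_two]
        linarith [pow_le_one₀ (n := 2 * j + 1) (abs_nonneg s) hs]
    _ = _ := by simp [mul_comm]

lemma abs_sum_pow_div_le {s : ℝ} (hs : |s| ≤ 1) (k : ℕ) :
    |∑ j ∈ Finset.range k, s ^ (2 * j + 2) / (j + 1 : ℝ)| ≤ 2 * k := by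
  refine (Finset.abs_sum_le_sum_abs _ _).trans ?_
  calc _ ≤ ∑ j ∈ Finset.range k, (2 : ℝ) := by
        refine Finset.sum_le_sum fun j _ => ?_
        rw [abs_div, abs_pow, abs_of_nonneg (by positivity : (0 : ℝ) ≤ j + 1)]
        have : |s| ^ (2 * j + 2) / (j + 1 : ℝ) ≤ 1 / 1 := by
          gcongr
          · exact pow_le_one₀ (abs_nonneg s) hs
          · simp
        linarith
    _ = _ := by simp [mul_comm]

lemma sum_two_mul_pow {s : ℝ} (hs0 : 0 ≤ s) (hs1 : s < 1) (k : ℕ) :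
    ∑ j ∈ Finset.range k, 2 * s ^ (2 * j + 1) = (1 - s ^ (2 * k)) * (2 * s / (1 - s ^ 2)) := by
  have h : 1 - s ^ 2 ≠ 0 := by nlinarith
  rw [mul_div_assoc', eq_div_iff h]
  induction k with
  | zero => simp
  | succ k ih => rw [Finset.sum_range_succ, add_mul, ih]; ring

/-- The generating function of the truncated series of `-log (1 - s ^ 2)`, weighted by the
coefficients of the even part of `(1 - x) ^ (-1 / 2)`. -/
noncomputable def truncatedLogSeries (x s : ℝ) : ℝ :=
  ∑' k : ℕ, ((2 * k).centralBinom / 16 ^ k : ℝ) * x ^ (2 * k) *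
    ∑ j ∈ Finset.range k, s ^ (2 * j + 2) / (j + 1 : ℝ)

lemma hasDerivAt_truncatedLogSeries {x s : ℝ} (hx : |x| < 1) (hs0 : 0 ≤ s) (hs1 : s < 1) :
    HasDerivAt (truncatedLogSeries x)
      (((1 / √(1 - x) - 1 / √(1 - x * s)) + (1 / √(1 + x) - 1 / √(1 + x * s))) / 2 *
        (2 * s / (1 - s ^ 2))) s := by
  have hmem : s ∈ Set.Ioo (-1 : ℝ) 1 := ⟨by linarith, hs1⟩
  have h := hasDerivAt_tsum_of_isPreconnected (t := Set.Ioo (-1 : ℝ) 1) (y := s) (y₀ := 0)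
    (g := fun k s => ((2 * k).centralBinom / 16 ^ k : ℝ) * x ^ (2 * k) *
      ∑ j ∈ Finset.range k, s ^ (2 * j + 2) / (j + 1 : ℝ))
    (g' := fun k s => ((2 * k).centralBinom / 16 ^ k : ℝ) * x ^ (2 * k) *
      ∑ j ∈ Finset.range k, 2 * s ^ (2 * j + 1))
    (summable_mul_pow_two_mul hx) isOpen_Ioo isPreconnected_Ioo
    (fun k y _ => by
      refine HasDerivAt.const_mul _ (HasDerivAt.fun_sum fun j _ => ?_)
      have hj : (j : ℝ) + 1 ≠ 0 := by positivity
      refine ((hasDerivAt_pow (2 * j + 2) y).div_const (j + 1 : ℝ)).congr_deriv ?_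
      push_cast
      field_simp)
    (fun k y hy => by
      rw [← mul_assoc]
      exact summand_bound (abs_sum_two_mul_pow_le (abs_lt.mpr hy).le k))
    (by simp) (by simp [summable_zero]) hmem
  refine HasDerivAt.congr_deriv h ?_
  refine HasSum.tsum_eq ?_
  have hxs : |x * s| < 1 := by
    rw [abs_mul, abs_of_nonneg hs0]
    nlinarith [abs_nonneg x]
  have h2 := ((hasSum_centralBinom_even hx).sub (hasSum_centralBinom_even hxs)).mul_right
    (2 * s / (1 - s ^ 2))
  convert! h2 using 1
  · ext k
    rw [sum_two_mul_pow hs0 hs1, mul_pow]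
    ring
  · ring

lemma continuousOn_truncatedLogSeries {x : ℝ} (hx : |x| < 1) :
    ContinuousOn (truncatedLogSeries x) (Set.Icc 0 1) := by
  refine continuousOn_tsum (fun k => by fun_prop) (summable_mul_pow_two_mul hx) fun k s hs => ?_
  rw [← mul_assoc]
  exact summand_bound (abs_sum_pow_div_le (abs_le.mpr ⟨by linarith [hs.1], hs.2⟩) k)

lemma truncatedLogSeries_one {x : ℝ} (hx0 : 0 < x) (hx1 : x < 1) :
    truncatedLogSeries x 1 =
      (2 * log (1 + √(1 - x)) - log (2 * √(1 - x)) - log (√(1 - x) + √(1 + x))) / √(1 - x) +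
      (2 * log (1 + √(1 + x)) - log (2 * √(1 + x)) - log (√(1 - x) + √(1 + x))) / √(1 + x) := by
  have hx : |x| < 1 := by rwa [abs_of_pos hx0]
  have hnx : |-x| < 1 := by rwa [abs_neg]
  have hx0' : -x ≠ 0 := neg_ne_zero.mpr hx0.ne'
  rw [← sqrtPrimitive_one_sub_zero hx0 hx1]
  refine eq_of_has_deriv_right_eq (a := 0) (b := 1)
    (g := fun s => ((sqrtPrimitive x s + sqrtPrimitive (-x) s) -
      (sqrtPrimitive x 0 + sqrtPrimitive (-x) 0)) / 2)
    (fun s hs => (hasDerivAt_truncatedLogSeries hx hs.1 hs.2).hasDerivWithinAt)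
    (fun s hs => ?_) (continuousOn_truncatedLogSeries hx) ?_ ?_ 1 (by simp)
  · have := (((hasDerivAt_sqrtPrimitive hx hx0.ne' hs.1 hs.2).add
      (hasDerivAt_sqrtPrimitive hnx hx0' hs.1 hs.2)).sub_const
      (sqrtPrimitive x 0 + sqrtPrimitive (-x) 0)).div_const 2
    refine (this.congr_deriv ?_).hasDerivWithinAt
    simp only [sub_neg_eq_add, neg_mul]
    ring
  · intro s hs
    have h1 := differentiableAt_sqrtPrimitive hx hx0.ne' hs.1 hs.2
    have h2 := differentiableAt_sqrtPrimitive hnx hx0' hs.1 hs.2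
    exact (((h1.add h2).sub_const _).div_const 2).continuousAt.continuousWithinAt
  · simp [truncatedLogSeries]

lemma log_sq_div_eq {u v : ℝ} (hu : 0 < u) (hv : 0 < v) :
    log ((1 / (u / √2) + √2) ^ 2 / (4 * (v / u + 1))) =
      2 * log (1 + u) - log (2 * u) - log (u + v) := by
  have h2 : √2 ^ 2 = 2 := Real.sq_sqrt (by norm_num)
  have h : (1 / (u / √2) + √2) ^ 2 / (4 * (v / u + 1)) = (1 + u) ^ 2 / (2 * u * (u + v)) := by
    have : 1 / (u / √2) + √2 = √2 * (1 + u) / u := by field_simp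
    rw [this, div_pow, mul_pow, h2]
    field_simp
    ring
  rw [h, Real.log_div (by positivity) (by positivity), Real.log_mul (by positivity) (by positivity),
    Real.log_pow]
  push_cast
  ring

theorem sun_4k_Hk_log (ψ : ℝ) (h0 : 0 < ψ) (h1 : ψ < π / 4) :
    ∑' k : ℕ, ((Nat.choose (4 * k) (2 * k) : ℝ) / 2 ^ (6 * k)) * (4 * cos (2 * ψ) ^ 2) ^ k *
        harmonicNum k =
      Real.log ((1 / sin ψ + Real.sqrt 2) ^ 2 / (4 * (cos ψ / sin ψ + 1))) /
          (Real.sqrt 2 * sin ψ) +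
        Real.log ((1 / cos ψ + Real.sqrt 2) ^ 2 / (4 * (tan ψ + 1))) /
          (Real.sqrt 2 * cos ψ) := by
  have hs : 0 < sin ψ := Real.sin_pos_of_pos_of_lt_pi h0 (by linarith [Real.pi_pos])
  have hc : 0 < cos ψ := Real.cos_pos_of_mem_Ioo ⟨by linarith [Real.pi_pos], by linarith⟩
  have hx0 : 0 < cos (2 * ψ) := Real.cos_pos_of_mem_Ioo ⟨by linarith [Real.pi_pos], by linarith⟩
  have hx1 : cos (2 * ψ) < 1 := by nlinarith [Real.cos_two_mul ψ, Real.sin_sq_add_cos_sq ψ]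
  have hu : √(1 - cos (2 * ψ)) = √2 * sin ψ := by
    rw [show 1 - cos (2 * ψ) = 2 * sin ψ ^ 2 by
      linarith [Real.cos_two_mul ψ, Real.sin_sq_add_cos_sq ψ],
      Real.sqrt_mul (by norm_num), Real.sqrt_sq hs.le]
  have hv : √(1 + cos (2 * ψ)) = √2 * cos ψ := by
    rw [show 1 + cos (2 * ψ) = 2 * cos ψ ^ 2 by linarith [Real.cos_two_mul ψ],
      Real.sqrt_mul (by norm_num), Real.sqrt_sq hc.le]
  have hmain := truncatedLogSeries_one hx0 hx1
  have hu0 : 0 < √2 * sin ψ := by positivity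
  have hv0 : 0 < √2 * cos ψ := by positivity
  have hsu : √2 * sin ψ / √2 = sin ψ := by field_simp
  have hcv : √2 * cos ψ / √2 = cos ψ := by field_simp
  have l1 := log_sq_div_eq hu0 hv0
  have l2 := log_sq_div_eq hv0 hu0
  rw [mul_div_mul_left _ _ (by positivity), hsu] at l1
  rw [mul_div_mul_left _ _ (by positivity), hcv, ← Real.tan_eq_sin_div_cos,
    add_comm (√2 * cos ψ) (√2 * sin ψ)] at l2
  rw [hu, hv, ← l1, ← l2] at hmain
  rw [← hmain]
  refine tsum_congr fun k => ?_
  simp only [one_pow, harmonicNum]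
  congr 1
  rw [Nat.centralBinom_eq_two_mul_choose, ← mul_assoc, mul_pow, ← pow_mul,
    show (2 : ℝ) ^ (6 * k) = 16 ^ k * 4 ^ k by rw [pow_mul, ← mul_pow]; norm_num]
  norm_num
  field_simp
end

section
/- The convergent series ∑_{k=0}^∞ C(3k,k)·((3+√5)/54)^k·(H_{3k} − H_{2k}) equals ((1+√5)/2)·( log 3 − 2·log((1+√5)/2) ). -/
open scoped BigOperators

theorem harmonicNum_succ (m : ℕ) : harmonicNum (m + 1) = harmonicNum m + 1 / (m + 1 : ℝ) := by
  simp [harmonicNum, Finset.sum_range_succ]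

/-- A binomial coefficient times a difference of harmonic numbers is a convolution of
binomial coefficients with `1 / (j + 1)`. -/
theorem choose_mul_harmonicNum_sub (n k : ℕ) :
    (Nat.choose (n + (k + 1)) (k + 1) : ℝ) * (harmonicNum (n + (k + 1)) - harmonicNum n) =
      ∑ p ∈ Finset.HasAntidiagonal.antidiagonal k, (Nat.choose (n + p.1) p.1 : ℝ) / (p.2 + 1) := by
  induction n generalizing k with
  | zero =>
    simp only [zero_add, Nat.choose_self]
    rw [Finset.Nat.sum_antidiagonal_eq_sum_range_succ_mk, ← Finset.sum_range_reflect]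
    simp only [harmonicNum, Finset.range_zero, Finset.sum_empty, sub_zero, Nat.cast_one, one_mul]
    refine Finset.sum_congr rfl fun j hj => ?_
    have hjk : k - (k + 1 - 1 - j) = j := by
      have := Finset.mem_range.mp hj
      omega
    simp only [hjk]
  | succ n ihn =>
    induction k with
    | zero =>
      simp only [zero_add, harmonicNum_succ (n + 1), Nat.choose_one_right,
        Finset.Nat.antidiagonal_zero, Finset.sum_singleton, add_zero, Nat.choose_zero_right]
      push_cast
      field_simp
      ring
    | succ k ihk =>
      have pascal : ∑ p ∈ Finset.HasAntidiagonal.antidiagonal (k + 1),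
            (Nat.choose (n + 1 + p.1) p.1 : ℝ) / (p.2 + 1) =
          ∑ p ∈ Finset.HasAntidiagonal.antidiagonal (k + 1), (Nat.choose (n + p.1) p.1 : ℝ) / (p.2 + 1) +
          ∑ p ∈ Finset.HasAntidiagonal.antidiagonal k, (Nat.choose (n + 1 + p.1) p.1 : ℝ) / (p.2 + 1) := by
        rw [Finset.Nat.sum_antidiagonal_succ, Finset.Nat.sum_antidiagonal_succ,
          add_assoc (_ / _), ← Finset.sum_add_distrib]
        simp only [add_zero, Nat.choose_zero_right]
        congr 1
        refine Finset.sum_congr rfl fun p _ => ?_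
        rw [← add_div, show n + 1 + (p.1 + 1) = (n + 1 + p.1) + 1 by ring,
          Nat.choose_succ_succ, show n + (p.1 + 1) = n + 1 + p.1 by ring]
        push_cast
        ring
      rw [pascal, ← ihn, ← ihk]
      have hN : n + 1 + (k + 1 + 1) = (n + (k + 1 + 1)) + 1 := by ring
      have hN' : n + 1 + (k + 1) = n + (k + 1 + 1) := by ring
      rw [hN, hN', Nat.choose_succ_succ, harmonicNum_succ, harmonicNum_succ n]
      have key := Nat.choose_mul_succ_eq (n + (k + 1 + 1)) (k + 1 + 1)
      rw [Nat.choose_succ_succ,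
        show n + (k + 1 + 1) + 1 - (k + 1 + 1) = n + 1 by omega] at key
      have key' := congrArg (Nat.cast : ℕ → ℝ) key
      push_cast at key' ⊢
      have h1 : (n : ℝ) + 1 ≠ 0 := by positivity
      have h2 : (n : ℝ) + (k + 1 + 1) + 1 ≠ 0 := by positivity
      field_simp
      linear_combination (-1 : ℝ) * key'

theorem choose_three_mul_add_le (a k : ℕ) :
    (Nat.choose (3 * k + a) k : ℝ) ≤ (27 / 4) ^ k * (3 / 2) ^ a := by
  have h := add_pow (1 / 3 : ℝ) (2 / 3) (3 * k + a)
  have hle := Finset.single_le_sum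
    (f := fun m => (1 / 3 : ℝ) ^ m * (2 / 3) ^ (3 * k + a - m) * (Nat.choose (3 * k + a) m : ℝ))
    (fun i _ => by positivity) (Finset.mem_range.mpr (show k < 3 * k + a + 1 by omega))
  rw [← h] at hle
  norm_num only [one_pow] at hle
  rw [show 3 * k + a - k = 2 * k + a by omega, pow_add, pow_mul] at hle
  have hc : (27 / 4 : ℝ) ^ k * (3 / 2) ^ a * ((1 / 3) ^ k * (((2 / 3) ^ 2) ^ k * (2 / 3) ^ a)) = 1 := by
    rw [show (27 / 4 : ℝ) ^ k * (3 / 2) ^ a * ((1 / 3) ^ k * (((2 / 3) ^ 2) ^ k * (2 / 3) ^ a)) =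
      ((27 / 4) ^ k * (1 / 3) ^ k * ((2 / 3) ^ 2) ^ k) * ((3 / 2) ^ a * (2 / 3) ^ a) by ring,
      ← mul_pow, ← mul_pow, ← mul_pow]
    norm_num
  calc (Nat.choose (3 * k + a) k : ℝ)
      = (27 / 4 : ℝ) ^ k * (3 / 2) ^ a * ((1 / 3) ^ k * (((2 / 3) ^ 2) ^ k * (2 / 3) ^ a) *
          (Nat.choose (3 * k + a) k : ℝ)) := by rw [← mul_assoc, hc, one_mul]
    _ ≤ (27 / 4 : ℝ) ^ k * (3 / 2) ^ a * 1 := by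
        refine mul_le_mul_of_nonneg_left ?_ (by positivity)
        norm_num at hle ⊢
        exact hle
    _ = _ := mul_one _

theorem summable_choose_three_mul_add {x : ℝ} (hx0 : 0 ≤ x) (hx : x < 4 / 27) (a : ℕ) :
    Summable fun k : ℕ => (Nat.choose (3 * k + a) k : ℝ) * x ^ k := by
  refine Summable.of_nonneg_of_le (fun k => by positivity) (fun k => ?_)
    ((summable_geometric_of_lt_one (r := 27 / 4 * x) (by positivity) (by linarith)).mul_left
      ((3 / 2 : ℝ) ^ a))
  calc _ ≤ (27 / 4 : ℝ) ^ k * (3 / 2) ^ a * x ^ k :=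
        mul_le_mul_of_nonneg_right (choose_three_mul_add_le a k) (by positivity)
    _ = _ := by rw [mul_pow]; ring

theorem tsum_choose_three_mul_add_le {x : ℝ} (hx0 : 0 ≤ x) (hx : x < 4 / 27) (a : ℕ) :
    ∑' k : ℕ, (Nat.choose (3 * k + a) k : ℝ) * x ^ k ≤ (3 / 2) ^ a * (1 - 27 / 4 * x)⁻¹ := by
  rw [← tsum_geometric_of_lt_one (r := 27 / 4 * x) (by positivity) (by linarith), ← tsum_mul_left]
  refine (summable_choose_three_mul_add hx0 hx a).tsum_le_tsum (fun k => ?_)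
    ((summable_geometric_of_lt_one (r := 27 / 4 * x) (by positivity) (by linarith)).mul_left _)
  calc _ ≤ (27 / 4 : ℝ) ^ k * (3 / 2) ^ a * x ^ k :=
        mul_le_mul_of_nonneg_right (choose_three_mul_add_le a k) (by positivity)
    _ = _ := by rw [mul_pow]; ring

theorem tsum_choose_three_mul_add_succ {x : ℝ} (hx0 : 0 ≤ x) (hx : x < 4 / 27) (a : ℕ) :
    ∑' k : ℕ, (Nat.choose (3 * k + (a + 1)) k : ℝ) * x ^ k =
      ∑' k : ℕ, (Nat.choose (3 * k + a) k : ℝ) * x ^ k +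
        x * ∑' k : ℕ, (Nat.choose (3 * k + (a + 3)) k : ℝ) * x ^ k := by
  rw [(summable_choose_three_mul_add hx0 hx (a + 1)).tsum_eq_zero_add,
    (summable_choose_three_mul_add hx0 hx a).tsum_eq_zero_add, ← tsum_mul_left, add_assoc,
    ← Summable.tsum_add
      ((summable_nat_add_iff 1).mpr (summable_choose_three_mul_add hx0 hx a))
      ((summable_choose_three_mul_add hx0 hx (a + 3)).mul_left x)]
  simp only [Nat.choose_zero_right]
  congr 1
  refine tsum_congr fun k => ?_
  rw [show 3 * (k + 1) + (a + 1) = (3 * (k + 1) + a) + 1 by ring, Nat.choose_succ_succ,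
    show 3 * (k + 1) + a = 3 * k + (a + 3) by ring]
  push_cast
  ring

theorem tsum_choose_three_mul_sub {x : ℝ} (hx0 : 0 ≤ x) (hx : x < 4 / 27) :
    ∑' k : ℕ, (Nat.choose (3 * k + 0) k : ℝ) * x ^ k -
      3 * x * ∑' k : ℕ, (Nat.choose (3 * k + 2) k : ℝ) * x ^ k = 1 := by
  rw [(summable_choose_three_mul_add hx0 hx 0).tsum_eq_zero_add, ← tsum_mul_left]
  have : ∀ k : ℕ, (Nat.choose (3 * (k + 1) + 0) (k + 1) : ℝ) * x ^ (k + 1) =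
      3 * x * ((Nat.choose (3 * k + 2) k : ℝ) * x ^ k) := by
    intro k
    have h := Nat.add_one_mul_choose_eq (3 * k + 2) k
    have h' := congrArg (Nat.cast : ℕ → ℝ) h
    push_cast at h'
    have hc : (Nat.choose (3 * (k + 1) + 0) (k + 1) : ℝ) = 3 * Nat.choose (3 * k + 2) k := by
      have hk : (k : ℝ) + 1 ≠ 0 := by positivity
      rw [show 3 * (k + 1) + 0 = 3 * k + 2 + 1 by ring]
      apply mul_right_cancel₀ hk
      linear_combination -h'
    rw [hc]
    ring
  rw [tsum_congr this]
  simp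

theorem mul_one_sub_sq_lt {t : ℝ} (ht : t < 1 / 3) : t * (1 - t) ^ 2 < 4 / 27 := by
  nlinarith [mul_pos (pow_pos (sub_pos.mpr ht) 2) (show (0 : ℝ) < 4 / 3 - t by linarith)]

/-- A solution of a linear recurrence that is contracting at growth rate `3 / 2` and which grows
at most at that rate vanishes. -/
theorem eq_zero_of_recurrence {E : ℕ → ℝ} {c d M : ℝ} (hc : 0 ≤ c) (hd : 0 ≤ d)
    (hcd : c * (9 / 4) + d * (3 / 2) < 1) (hrec : ∀ a, E a = c * E (a + 2) + d * E (a + 1))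
    (hM : ∀ a, |E a| ≤ M * (3 / 2) ^ a) (a : ℕ) : E a = 0 := by
  have bound : ∀ n a : ℕ, |E a| ≤ M * (c * (9 / 4) + d * (3 / 2)) ^ n * (3 / 2) ^ a := by
    intro n
    induction n with
    | zero => simpa using hM
    | succ n ih =>
      intro a
      calc |E a| ≤ c * |E (a + 2)| + d * |E (a + 1)| := by
            rw [hrec a]
            refine (abs_add_le _ _).trans_eq ?_
            rw [abs_mul, abs_mul, abs_of_nonneg hc, abs_of_nonneg hd]
        _ ≤ _ := add_le_add (mul_le_mul_of_nonneg_left (ih (a + 2)) hc)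
            (mul_le_mul_of_nonneg_left (ih (a + 1)) hd)
        _ = _ := by ring
  have lim : Filter.Tendsto (fun n : ℕ => M * (c * (9 / 4) + d * (3 / 2)) ^ n * (3 / 2) ^ a)
      Filter.atTop (nhds 0) := by
    simpa using ((tendsto_pow_atTop_nhds_zero_of_lt_one (by positivity) hcd).const_mul
      M).mul_const ((3 / 2 : ℝ) ^ a)
  exact abs_nonpos_iff.mp (ge_of_tendsto' lim fun n => bound n a)

theorem tsum_choose_three_mul_add_succ_eq {t : ℝ} (ht0 : 0 ≤ t) (ht : t < 1 / 3) (a : ℕ) :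
    ∑' k : ℕ, (Nat.choose (3 * k + a) k : ℝ) * (t * (1 - t) ^ 2) ^ k =
      (1 - t) * ∑' k : ℕ, (Nat.choose (3 * k + (a + 1)) k : ℝ) * (t * (1 - t) ^ 2) ^ k := by
  have hx0 : 0 ≤ t * (1 - t) ^ 2 := by positivity
  have hx := mul_one_sub_sq_lt ht
  have hrec := tsum_choose_three_mul_add_succ hx0 hx
  have hle := tsum_choose_three_mul_add_le hx0 hx
  have hnn : ∀ a : ℕ, 0 ≤ ∑' k : ℕ, (Nat.choose (3 * k + a) k : ℝ) * (t * (1 - t) ^ 2) ^ k :=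
    fun a => tsum_nonneg fun k => by positivity
  generalize hF : (fun a : ℕ =>
    ∑' k : ℕ, (Nat.choose (3 * k + a) k : ℝ) * (t * (1 - t) ^ 2) ^ k) = F at *
  have hF' := fun a => congrFun hF a
  simp only [hF'] at hrec hle hnn ⊢
  have ht1 : 0 < 1 - t := by linarith
  set C := (1 - 27 / 4 * (t * (1 - t) ^ 2))⁻¹
  have h0 := eq_zero_of_recurrence (E := fun a => F a - (1 - t) * F (a + 1))
    (c := t * (1 - t)) (d := t) (M := 5 / 2 * C) (by positivity) ht0 (by nlinarith)
    (fun a => by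
      simp only [show a + 2 + 1 = a + 3 by ring, show a + 1 + 1 = a + 2 by ring]
      linear_combination -hrec a)
    (fun a => by
      have h1 := hle a
      have h2 := hle (a + 1)
      have h3 := hnn a
      have h4 := hnn (a + 1)
      rw [pow_succ] at h2
      refine abs_le.mpr ⟨?_, ?_⟩ <;> nlinarith)
    a
  linarith

theorem tsum_choose_three_mul_add {t : ℝ} (ht0 : 0 ≤ t) (ht : t < 1 / 3) (a : ℕ) :
    (1 - 3 * t) * (1 - t) ^ a *
      ∑' k : ℕ, (Nat.choose (3 * k + a) k : ℝ) * (t * (1 - t) ^ 2) ^ k = 1 := by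
  induction a with
  | zero =>
    have h := tsum_choose_three_mul_sub (x := t * (1 - t) ^ 2) (by positivity)
      (mul_one_sub_sq_lt ht)
    have h0 := tsum_choose_three_mul_add_succ_eq ht0 ht 0
    have h1 := tsum_choose_three_mul_add_succ_eq ht0 ht 1
    simp only [zero_add, Nat.reduceAdd] at h0 h1
    rw [h1] at h0
    linear_combination h - 3 * t * h0
  | succ a ih =>
    rw [tsum_choose_three_mul_add_succ_eq ht0 ht a] at ih
    linear_combination ih

theorem hasSum_choose_three_mul_harmonicNum {t : ℝ} (ht0 : 0 ≤ t) (ht : t < 1 / 3) :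
    HasSum (fun k : ℕ => (Nat.choose (3 * k) k : ℝ) * (t * (1 - t) ^ 2) ^ k *
      (harmonicNum (3 * k) - harmonicNum (2 * k))) (-Real.log (1 - t) / (1 - 3 * t)) := by
  have hx0 : 0 ≤ t * (1 - t) ^ 2 := by positivity
  have hx := mul_one_sub_sq_lt ht
  have ht1 : 1 - t ≠ 0 := by linarith
  have ht3 : 1 - 3 * t ≠ 0 := by linarith
  set x := t * (1 - t) ^ 2 with hxdef
  let f : ℕ × ℕ → ℝ := fun p =>
    x ^ (p.2 + 1) / (p.2 + 1) * ((Nat.choose (3 * p.1 + 2 * (p.2 + 1)) p.1 : ℝ) * x ^ p.1)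
  have inner : ∀ j : ℕ, HasSum (fun i => f (i, j)) (t ^ (j + 1) / (j + 1) / (1 - 3 * t)) := by
    intro j
    have hs := tsum_choose_three_mul_add ht0 ht (2 * (j + 1))
    rw [← hxdef] at hs
    have hp : x ^ (j + 1) = t ^ (j + 1) * (1 - t) ^ (2 * (j + 1)) := by
      rw [hxdef, mul_pow, ← pow_mul]
    have hv : t ^ (j + 1) / (j + 1) / (1 - 3 * t) = x ^ (j + 1) / (j + 1) *
        ∑' k : ℕ, (Nat.choose (3 * k + 2 * (j + 1)) k : ℝ) * x ^ k := by
      rw [hp, div_eq_iff ht3]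
      linear_combination -(t ^ (j + 1) / (j + 1)) * hs
    rw [hv]
    exact (summable_choose_three_mul_add hx0 hx (2 * (j + 1))).hasSum.mul_left _
  have outer : HasSum (fun j : ℕ => t ^ (j + 1) / (j + 1) / (1 - 3 * t))
      (-Real.log (1 - t) / (1 - 3 * t)) :=
    (Real.hasSum_pow_div_log_of_abs_lt_one (by rw [abs_of_nonneg ht0]; linarith)).div_const _
  have summ : Summable fun p : ℕ × ℕ => f p.swap := by
    refine (summable_prod_of_nonneg fun p => ?_).mpr ⟨fun j => (inner j).summable, ?_⟩
    · simp only [f, Pi.zero_apply]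
      positivity
    · exact outer.summable.congr fun j => ((inner j).tsum_eq).symm
  have total : HasSum f (-Real.log (1 - t) / (1 - 3 * t)) := by
    have h := summ.hasSum
    rw [(h.prod_fiberwise inner).unique outer] at h
    exact (Equiv.prodComm ℕ ℕ).hasSum_iff.mp h
  have anti := (Finset.HasAntidiagonal.sigmaAntidiagonalEquivProd.hasSum_iff.mpr total).sigma
    fun n => hasSum_fintype _
  rw [← hasSum_nat_add_iff' 1]
  simp only [Finset.range_one, Finset.sum_singleton, mul_zero, sub_self, sub_zero]
  refine Eq.mpr (congrArg (HasSum · _) (funext fun n => ?_)) anti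
  have h := choose_mul_harmonicNum_sub (2 * (n + 1)) n
  rw [show 2 * (n + 1) + (n + 1) = 3 * (n + 1) by ring] at h
  rw [mul_right_comm, h, Finset.sum_mul, ← Finset.sum_coe_sort]
  refine Finset.sum_congr rfl fun p _ => ?_
  have hp : p.1.1 + p.1.2 = n := Finset.HasAntidiagonal.mem_antidiagonal.mp p.2
  simp only [f, Function.comp, Finset.HasAntidiagonal.sigmaAntidiagonalEquivProd_apply]
  rw [show 3 * p.1.1 + 2 * (p.1.2 + 1) = 2 * (n + 1) + p.1.1 by omega,
    show n + 1 = p.1.2 + 1 + p.1.1 by omega, pow_add]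
  ring

theorem sun_3k_golden :
    ∑' k : ℕ, (Nat.choose (3 * k) k : ℝ) * ((3 + Real.sqrt 5) / 54) ^ k *
        (harmonicNum (3 * k) - harmonicNum (2 * k)) =
      ((1 + Real.sqrt 5) / 2) * (Real.log 3 - 2 * Real.log ((1 + Real.sqrt 5) / 2)) := by
  have h5 : Real.sqrt 5 ^ 2 = 5 := Real.sq_sqrt (by norm_num)
  have hlo : 2 < Real.sqrt 5 := Real.lt_sqrt_of_sq_lt (by norm_num)
  have hhi : Real.sqrt 5 < 3 := (Real.sqrt_lt' (by norm_num)).mpr (by norm_num)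
  generalize Real.sqrt 5 = s at *
  have h := hasSum_choose_three_mul_harmonicNum (t := (3 - s) / 6) (by linarith) (by linarith)
  have hx : (3 - s) / 6 * (1 - (3 - s) / 6) ^ 2 = (3 + s) / 54 := by
    linear_combination (-(s + 3) / 216) * h5
  have hlog : 1 - (3 - s) / 6 = ((1 + s) / 2) ^ 2 / 3 := by
    linear_combination (-1 / 12) * h5
  have hq : 1 - 3 * ((3 - s) / 6) = (s - 1) / 2 := by ring
  rw [hx, hlog, hq, Real.log_div (by positivity) (by norm_num), Real.log_pow] at h
  rw [h.tsum_eq, div_eq_iff (by linarith)]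
  push_cast
  linear_combination (-(Real.log 3 - 2 * Real.log ((1 + s) / 2)) / 4) * h5
end

section
/- The convergent series ∑_{k=1}^∞ 1/(k²·2^k·C(3k,k)) equals π²/24 − (log 2)²/2. -/
open scoped BigOperators
open Set Real MeasureTheory

/-- The dilogarithm series `∑ xⁿ / n²`, over `n ≥ 1`. -/
noncomputable def dilog (x : ℝ) : ℝ := ∑' n : ℕ, x ^ (n + 1) / ((n : ℝ) + 1) ^ 2

theorem hasSum_one_div_succ_sq :
    HasSum (fun n : ℕ => 1 / ((n : ℝ) + 1) ^ 2) (π ^ 2 / 6) := by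
  have h := (hasSum_nat_add_iff' (f := fun n : ℕ => (1 : ℝ) / (n : ℝ) ^ 2) 1).2 hasSum_zeta_two
  simpa using h

theorem norm_dilog_term_le {x : ℝ} (hx : |x| ≤ 1) (n : ℕ) :
    ‖x ^ (n + 1) / ((n : ℝ) + 1) ^ 2‖ ≤ 1 / ((n : ℝ) + 1) ^ 2 := by
  rw [norm_div, norm_pow, Real.norm_eq_abs, Real.norm_of_nonneg (by positivity)]
  gcongr
  exact pow_le_one₀ (abs_nonneg x) hx

theorem summable_dilog {x : ℝ} (hx : |x| ≤ 1) :
    Summable fun n : ℕ => x ^ (n + 1) / ((n : ℝ) + 1) ^ 2 :=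
  .of_norm_bounded hasSum_one_div_succ_sq.summable (norm_dilog_term_le hx)

theorem continuousOn_dilog : ContinuousOn dilog (Icc (-1) 1) :=
  continuousOn_tsum (fun n => by fun_prop) hasSum_one_div_succ_sq.summable
    fun n _ hx => norm_dilog_term_le (abs_le.2 hx) n

theorem dilog_zero : dilog 0 = 0 := by simp [dilog]

theorem dilog_one : dilog 1 = π ^ 2 / 6 := by
  simpa [dilog] using hasSum_one_div_succ_sq.tsum_eq

/-- The duplication formula at `1`, in the form of the value at `-1`. -/
theorem dilog_neg_one : dilog (-1) = -(π ^ 2 / 12) := by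
  have h1 := summable_dilog (x := 1) (by simp)
  have h2 := summable_dilog (x := -1) (by simp)
  have h3 := (h1.hasSum.add h2.hasSum)
  have h4 := hasSum_one_div_succ_sq.mul_left (1 / 2)
  have hodd : HasSum (fun k : ℕ => (1 : ℝ) ^ (2 * k + 1 + 1) / (((2 * k + 1 : ℕ) : ℝ) + 1) ^ 2
      + (-1 : ℝ) ^ (2 * k + 1 + 1) / (((2 * k + 1 : ℕ) : ℝ) + 1) ^ 2) (1 / 2 * (π ^ 2 / 6)) := by
    convert! h4 using 2 with k
    rw [show 2 * k + 1 + 1 = 2 * (k + 1) by ring, pow_mul]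
    push_cast
    field_simp
    norm_num
    ring
  have heven : HasSum (fun k : ℕ => (1 : ℝ) ^ (2 * k + 1) / (((2 * k : ℕ) : ℝ) + 1) ^ 2
      + (-1 : ℝ) ^ (2 * k + 1) / (((2 * k : ℕ) : ℝ) + 1) ^ 2) 0 := by
    convert! hasSum_zero using 2 with k
    rw [pow_succ (-1 : ℝ), pow_mul]
    norm_num
    ring
  have h5 := h3.unique (heven.even_add_odd hodd)
  change dilog 1 + dilog (-1) = _ at h5
  rw [dilog_one] at h5
  linarith

theorem hasSum_pow_div_succ {x : ℝ} (hx : |x| < 1) (h0 : x ≠ 0) :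
    HasSum (fun n : ℕ => x ^ n / ((n : ℝ) + 1)) (-log (1 - x) / x) := by
  convert! (hasSum_pow_div_log_of_abs_lt_one hx).div_const x using 2 with n
  rw [pow_succ]
  field_simp

theorem norm_pow_div_succ_le {x r : ℝ} (hx : |x| ≤ r) (n : ℕ) :
    ‖x ^ n / ((n : ℝ) + 1)‖ ≤ r ^ n := by
  rw [norm_div, norm_pow, Real.norm_eq_abs, Real.norm_of_nonneg (by positivity)]
  exact (div_le_self (by positivity) (by linarith [n.cast_nonneg (α := ℝ)])).trans
    (pow_le_pow_left₀ (abs_nonneg x) hx n)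

theorem hasDerivAt_dilog {x : ℝ} (hx : |x| < 1) (h0 : x ≠ 0) :
    HasDerivAt dilog (-log (1 - x) / x) x := by
  obtain ⟨r, hxr, hr⟩ := exists_between hx
  have hr0 : 0 < r := (abs_nonneg x).trans_lt hxr
  rw [← (hasSum_pow_div_succ hx h0).tsum_eq]
  refine hasDerivAt_tsum_of_isPreconnected (t := Ioo (-r) r) (y₀ := 0)
    (summable_geometric_of_lt_one hr0.le hr) isOpen_Ioo isPreconnected_Ioo ?_
    (fun n y hy => norm_pow_div_succ_le (abs_lt.2 hy).le n) (by simpa using hr0)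
    (summable_dilog (by simp)) (abs_lt.1 hxr)
  intro n y _
  refine ((hasDerivAt_pow (n + 1) y).div_const (((n : ℝ) + 1) ^ 2)).congr_deriv ?_
  push_cast
  field_simp

theorem continuousOn_log_mul_log_one_sub :
    ContinuousOn (fun x : ℝ => log x * log (1 - x)) (Icc 0 (1 / 2)) := by
  have hS : ContinuousOn (fun x : ℝ => ∑' n : ℕ, x ^ n / ((n : ℝ) + 1)) (Icc 0 (1 / 2)) :=
    continuousOn_tsum (fun n => by fun_prop)
      (summable_geometric_of_lt_one (r := (1 / 2 : ℝ)) (by norm_num) (by norm_num))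
      fun n x hx => norm_pow_div_succ_le (abs_le.2 ⟨by linarith [hx.1], hx.2⟩) n
  refine ((continuous_mul_log.continuousOn.mul hS).neg).congr fun x hx => ?_
  rcases eq_or_ne x 0 with rfl | h0
  · simp
  · have hx1 : |x| < 1 := abs_lt.2 ⟨by linarith [hx.1], by linarith [hx.2]⟩
    simp only [Pi.neg_apply, Pi.mul_apply, (hasSum_pow_div_succ hx1 h0).tsum_eq]
    field_simp

/-- Euler's reflection formula `Li₂ x + Li₂ (1 - x) = π² / 6 - log x * log (1 - x)` at `1 / 2`. -/
theorem dilog_half : dilog (1 / 2) = π ^ 2 / 12 - log 2 ^ 2 / 2 := by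
  have hc : ContinuousOn (fun x : ℝ => dilog x + dilog (1 - x) + log x * log (1 - x))
      (Icc 0 (1 / 2)) := by
    refine ((continuousOn_dilog.mono ?_).add (continuousOn_dilog.comp (by fun_prop) ?_)).add
      continuousOn_log_mul_log_one_sub
    · exact Icc_subset_Icc (by norm_num) (by norm_num)
    · intro x hx
      exact ⟨by linarith [hx.2], by linarith [hx.1]⟩
  have hd : ∀ x ∈ Ioo (0 : ℝ) (1 / 2),
      HasDerivAt (fun x : ℝ => dilog x + dilog (1 - x) + log x * log (1 - x)) 0 x := by
    intro x hx
    have hx0 : x ≠ 0 := hx.1.ne'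
    have hx1 : 1 - x ≠ 0 := by linarith [hx.2]
    have hs : HasDerivAt (fun x : ℝ => 1 - x) (-1) x := by
      simpa using (hasDerivAt_id x).const_sub 1
    have h1 := hasDerivAt_dilog (abs_lt.2 ⟨by linarith [hx.1], by linarith [hx.2]⟩) hx0
    have h2 := (hasDerivAt_dilog (x := 1 - x)
      (abs_lt.2 ⟨by linarith [hx.2], by linarith [hx.1]⟩) hx1).comp x hs
    refine ((h1.add h2).add ((hasDerivAt_log hx0).mul (hs.log hx1))).congr_deriv ?_
    rw [sub_sub_cancel]
    field_simp
    ring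
  obtain ⟨c, -, h⟩ := exists_hasDerivAt_eq_slope _ (fun _ => 0) (by norm_num) hc hd
  have hl : log (1 / 2) = -log 2 := by rw [one_div, log_inv]
  norm_num [dilog_zero, dilog_one, sub_eq_zero] at h hl ⊢
  rw [hl] at h
  linarith

theorem integral_pow_mul_one_sub_pow (a b : ℕ) :
    ∫ x in (0 : ℝ)..1, x ^ a * (1 - x) ^ b =
      (a.factorial : ℝ) * b.factorial / (a + b + 1).factorial := by
  induction b generalizing a with
  | zero =>
    simp [integral_pow, Nat.factorial_succ]
    field_simp
  | succ b ih =>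
    have hd : ∀ x ∈ uIcc (0 : ℝ) 1, HasDerivAt (fun x : ℝ => x ^ (a + 1) * (1 - x) ^ (b + 1))
        ((a + 1) * (x ^ a * (1 - x) ^ (b + 1)) - (b + 1) * (x ^ (a + 1) * (1 - x) ^ b)) x := by
      intro x _
      refine ((hasDerivAt_pow (a + 1) x).mul
        (((hasDerivAt_id x).const_sub 1).pow (b + 1))).congr_deriv ?_
      simp
      ring
    have h := intervalIntegral.integral_eq_sub_of_hasDerivAt hd
      (Continuous.intervalIntegrable (by fun_prop) _ _)
    rw [intervalIntegral.integral_sub (Continuous.intervalIntegrable (by fun_prop) _ _)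
      (Continuous.intervalIntegrable (by fun_prop) _ _), intervalIntegral.integral_const_mul,
      intervalIntegral.integral_const_mul, ih] at h
    rw [show a + 1 + b + 1 = a + (b + 1) + 1 by ring] at h
    simp [Nat.factorial_succ] at h ⊢
    field_simp at h ⊢
    rw [mul_zero, mul_eq_zero, or_iff_right (by positivity)] at h
    linarith

theorem integral_eq_one_div_choose (k : ℕ) :
    ∫ x in (0 : ℝ)..1, x ^ k * (1 - x) ^ (2 * k + 2) / ((k + 1) * 2 ^ (k + 1)) =
      1 / ((k + 1 : ℝ) ^ 2 * 2 ^ (k + 1) * (Nat.choose (3 * (k + 1)) (k + 1) : ℝ)) := by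
  rw [intervalIntegral.integral_div, integral_pow_mul_one_sub_pow,
    Nat.cast_choose ℝ (by omega : k + 1 ≤ 3 * (k + 1)),
    show 3 * (k + 1) - (k + 1) = 2 * k + 2 by omega,
    show k + (2 * k + 2) + 1 = 3 * (k + 1) by ring, Nat.factorial_succ k]
  push_cast
  field_simp

theorem norm_integrand_le {x : ℝ} (hx : x ∈ Icc (0 : ℝ) 1) (k : ℕ) :
    ‖x ^ k * (1 - x) ^ (2 * k + 2) / ((k + 1) * 2 ^ (k + 1))‖ ≤ (1 / 2) ^ k := by
  have hx' : 0 ≤ 1 - x := by linarith [hx.2]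
  have h0 : (0 : ℝ) ≤ x ^ k * (1 - x) ^ (2 * k + 2) :=
    mul_nonneg (pow_nonneg hx.1 _) (pow_nonneg hx' _)
  rw [Real.norm_of_nonneg (by positivity), one_div_pow]
  refine div_le_div₀ zero_le_one (mul_le_one₀ (pow_le_one₀ hx.1 hx.2) (pow_nonneg hx' _)
    (pow_le_one₀ hx' (by linarith [hx.1]))) (by positivity) ?_
  rw [pow_succ]
  have : (0 : ℝ) < 2 ^ k := by positivity
  nlinarith [k.cast_nonneg (α := ℝ), mul_nonneg (k.cast_nonneg (α := ℝ)) this.le]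

/-- The factorization `2 - x (1 - x)² = (2 - x) (1 + x²)` splits the logarithm. -/
theorem tsum_integrand {x : ℝ} (hx : x ∈ Ioo (0 : ℝ) 1) :
    ∑' k : ℕ, x ^ k * (1 - x) ^ (2 * k + 2) / ((k + 1) * 2 ^ (k + 1)) =
      -log (1 - x / 2) / x - log (1 + x ^ 2) / x := by
  obtain ⟨hx0, hx1⟩ := hx
  have hy : |x * (1 - x) ^ 2 / 2| < 1 := by
    rw [abs_of_nonneg (by positivity)]
    nlinarith [mul_pos hx0 (sub_pos.2 hx1)]
  have h := (hasSum_pow_div_log_of_abs_lt_one hy).div_const x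
  rw [show 1 - x * (1 - x) ^ 2 / 2 = (1 - x / 2) * (1 + x ^ 2) by ring,
    log_mul (by linarith) (by positivity)] at h
  rw [← sub_div, ← neg_add', ← h.tsum_eq]
  refine tsum_congr fun k => ?_
  rw [div_pow, mul_pow, ← pow_mul, show 2 * (k + 1) = 2 * k + 2 by ring, pow_succ x]
  field_simp

theorem continuousOn_tsum_integrand :
    ContinuousOn (fun x : ℝ => ∑' k : ℕ, x ^ k * (1 - x) ^ (2 * k + 2) / ((k + 1) * 2 ^ (k + 1)))
      (Icc 0 1) :=
  continuousOn_tsum (fun k => by fun_prop)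
    (summable_geometric_of_lt_one (r := (1 / 2 : ℝ)) (by norm_num) (by norm_num))
    fun k _ hx => norm_integrand_le hx k

theorem integral_tsum_integrand :
    ∫ x in (0 : ℝ)..1, ∑' k : ℕ, x ^ k * (1 - x) ^ (2 * k + 2) / ((k + 1) * 2 ^ (k + 1)) =
      dilog (1 / 2) + dilog (-1) / 2 := by
  have hc : ContinuousOn (fun x : ℝ => dilog (x / 2) + dilog (-x ^ 2) / 2) (Icc 0 1) := by
    refine (continuousOn_dilog.comp (by fun_prop) ?_).add
      ((continuousOn_dilog.comp (by fun_prop) ?_).div_const 2)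
    · intro x hx
      exact ⟨by linarith [hx.1], by linarith [hx.2]⟩
    · intro x hx
      exact ⟨by nlinarith [hx.1, hx.2], by nlinarith [hx.1, hx.2]⟩
  rw [intervalIntegral.integral_eq_sub_of_hasDerivAt_of_le zero_le_one hc]
  · simp [dilog_zero]
  · intro x hx
    have hx0 : x ≠ 0 := hx.1.ne'
    have h1 := (hasDerivAt_dilog (x := x / 2)
      (abs_lt.2 ⟨by linarith [hx.1], by linarith [hx.2]⟩) (by positivity)).comp x
      ((hasDerivAt_id x).div_const 2)
    have h2 := (hasDerivAt_dilog (x := -x ^ 2)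
      (abs_lt.2 ⟨by nlinarith [hx.1, hx.2], by nlinarith [hx.1, hx.2]⟩)
      (neg_ne_zero.2 (by positivity))).comp x (hasDerivAt_pow 2 x).neg
    refine (h1.add (h2.div_const 2)).congr_deriv ?_
    rw [tsum_integrand hx, sub_neg_eq_add]
    field_simp
    simp
    ring
  · exact ContinuousOn.intervalIntegrable_of_Icc zero_le_one continuousOn_tsum_integrand

theorem hasSum_integral_integrand :
    HasSum (fun k : ℕ => ∫ x in (0 : ℝ)..1, x ^ k * (1 - x) ^ (2 * k + 2) / ((k + 1) * 2 ^ (k + 1)))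
      (∫ x in (0 : ℝ)..1, ∑' k : ℕ, x ^ k * (1 - x) ^ (2 * k + 2) / ((k + 1) * 2 ^ (k + 1))) := by
  have hg : Summable fun k : ℕ => (1 / 2 : ℝ) ^ k :=
    summable_geometric_of_lt_one (by norm_num) (by norm_num)
  have hmem : ∀ x ∈ uIoc (0 : ℝ) 1, x ∈ Icc (0 : ℝ) 1 := fun x hx => by
    rw [uIoc_of_le zero_le_one] at hx
    exact Ioc_subset_Icc_self hx
  refine intervalIntegral.hasSum_integral_of_dominated_convergence (fun k _ => (1 / 2) ^ k)
    (fun k => Continuous.aestronglyMeasurable (by fun_prop)) ?_ ?_ ?_ ?_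
  · exact fun k => .of_forall fun x hx => norm_integrand_le (hmem x hx) k
  · exact .of_forall fun _ _ => hg
  · exact intervalIntegrable_const
  · exact .of_forall fun x hx =>
      (Summable.of_norm_bounded hg (norm_integrand_le (hmem x hx))).hasSum

theorem sun_inv3k_two :
    ∑' k : ℕ, 1 / ((k + 1 : ℝ) ^ 2 * 2 ^ (k + 1) * (Nat.choose (3 * (k + 1)) (k + 1) : ℝ)) =
      Real.pi ^ 2 / 24 - Real.log 2 ^ 2 / 2 := by
  simp_rw [← integral_eq_one_div_choose]
  rw [hasSum_integral_integrand.tsum_eq, integral_tsum_integrand, dilog_half, dilog_neg_one]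
  ring
end
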